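/- Fix an integer k ≥ 3 and set M = M(N) := ⌊N^(1/k)⌋. Then for every ε > 0 there exists N₀ such that for all N ≥ N₀, (1/N^(k+1)) · Σ_{x ∈ (ℤ/Nℤ)ᵏ} Σ_{w ∈ ℤ/Nℤ} (η^x_w)² ≤ M^k/N + π²/6 + ε. -/

import Mathlib

/-- `η^x_w` is the number of `b ∈ {0,…,M-1}^k` with `b₁x₁ + ⋯ + b_kx_k ≡ w (mod N)`. -/
def eta (N M k : ℕ) (x : Fin k → ZMod N) (w : ZMod N) : ℕ :=
  (Finset.univ.filter
    (fun b : Fin k → Fin M => ∑ i, ((b i : ℕ) : ZMod N) * x i = w)).card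

/-- `Mfl k N = ⌊N^(1/k)⌋`, the integer part of the real `k`-th root of `N`. -/
noncomputable def Mfl (k N : ℕ) : ℕ := Nat.floor ((N : ℝ) ^ ((1 : ℝ) / k))

theorem sum_card_fiber_sq {α β : Type*} [Fintype α] [Fintype β] [DecidableEq β] (f : α → β) :
    ∑ w, (Finset.univ.filter fun b => f b = w).card ^ 2 =
      ∑ b, ∑ b', if f b = f b' then 1 else 0 := by
  simp_rw [sq, Finset.card_filter, Finset.sum_mul_sum]
  rw [Finset.sum_comm]
  refine Finset.sum_congr rfl fun b _ => ?_
  rw [Finset.sum_comm]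
  refine Finset.sum_congr rfl fun b' _ => ?_
  rw [Finset.sum_eq_single (f b)]
  · simp [eq_comm]
  · intro w _ hw
    simp [hw.symm]
  · simp

/-- The number of solutions of a linear equation modulo `N` is at most `N ^ (k - 1)` times a
common divisor of the coefficients. -/
theorem exists_dvd_card_linear_solutions_mul_le {k : ℕ} (N : ℕ) [NeZero N] {a : Fin k → ℤ}
    (ha : a ≠ 0) :
    ∃ g : ℕ, (∀ i, (g : ℤ) ∣ a i) ∧
      (Finset.univ.filter fun x : Fin k → ZMod N => ∑ i, (a i : ZMod N) * x i = 0).card * N ≤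
        N ^ k * g := by
  set I : Ideal ℤ := Ideal.span (Set.range a) with hI
  set z := Submodule.IsPrincipal.generator I with hz
  have hspan : Ideal.span {z} = I := Submodule.IsPrincipal.span_singleton_generator I
  obtain ⟨c, hc⟩ : ∃ c : Fin k → ℤ, ∑ i, c i * a i = (z.natAbs : ℤ) := by
    rw [← Ideal.mem_span_range_iff_exists_fun, ← hI, ← hspan, Ideal.mem_span_singleton]
    exact Int.dvd_natAbs.2 dvd_rfl
  have hdvd : ∀ i, (z.natAbs : ℤ) ∣ a i := fun i => by
    rw [Int.natAbs_dvd, ← Ideal.mem_span_singleton, hspan]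
    exact Ideal.subset_span ⟨i, rfl⟩
  refine ⟨z.natAbs, hdvd, ?_⟩
  have hpos : 0 < z.natAbs := Nat.pos_of_ne_zero fun h0 =>
    ha (funext fun i => by simpa [h0] using hdvd i)
  let f : (Fin k → ZMod N) →+ ZMod N :=
    { toFun := fun x => ∑ i, (a i : ZMod N) * x i
      map_zero' := by simp
      map_add' := fun x y => by simp [mul_add, Finset.sum_add_distrib] }
  have hker : Nat.card f.ker =
      (Finset.univ.filter fun x : Fin k → ZMod N => ∑ i, (a i : ZMod N) * x i = 0).card := by
    rw [Nat.card_eq_fintype_card, Fintype.card_subtype]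
    congr 1
    ext x
    simp [f, AddMonoidHom.mem_ker]
  have hindex := f.ker.card_mul_index
  rw [hker, AddSubgroup.index_ker, Nat.card_fun, Nat.card_zmod, Nat.card_fin] at hindex
  have hmem : ((z.natAbs : ℕ) : ZMod N) ∈ f.range := by
    refine ⟨fun i => (c i : ZMod N), ?_⟩
    have := congrArg (Int.cast : ℤ → ZMod N) hc
    push_cast at this
    simpa [f, mul_comm] using this
  have hrange : N ≤ Nat.card f.range * z.natAbs := by
    have hle : addOrderOf ((z.natAbs : ℕ) : ZMod N) ≤ Nat.card f.range := by
      rw [← Nat.card_zmultiples]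
      exact AddSubgroup.card_le_of_le (AddSubgroup.zmultiples_le_of_mem hmem)
    rw [ZMod.addOrderOf_coe _ (NeZero.ne N)] at hle
    calc N = N / N.gcd z.natAbs * N.gcd z.natAbs := (Nat.div_mul_cancel (Nat.gcd_dvd_left _ _)).symm
      _ ≤ _ := Nat.mul_le_mul hle (Nat.gcd_le_right _ hpos)
  rw [← hindex, mul_assoc]
  exact Nat.mul_le_mul_left _ hrange

theorem card_fin_sub_dvd_le (M d : ℕ) (hd : 0 < d) (v : ℕ) :
    (Finset.univ.filter fun t : Fin M => (d : ℤ) ∣ (v : ℤ) - (t : ℕ)).card ≤ M / d + 1 := by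
  have h := Nat.count_modEq_card M hd v
  rw [Nat.count_eq_card_filter_range] at h
  have h2 : (Finset.univ.filter fun t : Fin M => (d : ℤ) ∣ (v : ℤ) - (t : ℕ)).card ≤
      ((Finset.range M).filter fun x => x ≡ v [MOD d]).card := by
    refine Finset.card_le_card_of_injOn (fun t : Fin M => (t : ℕ)) ?_ Fin.val_injective.injOn
    intro t ht
    simpa [Nat.modEq_iff_dvd] using ht
  split_ifs at h <;> omega

theorem card_pi_fin_sub_dvd_le {k : ℕ} (M d : ℕ) (hd : 0 < d) (b : Fin k → Fin M) :
    (Finset.univ.filter fun b' : Fin k → Fin M =>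
      ∀ i, (d : ℤ) ∣ ((b i : ℕ) : ℤ) - (b' i : ℕ)).card ≤ (M / d + 1) ^ k := by
  have h : (Finset.univ.filter fun b' : Fin k → Fin M =>
      ∀ i, (d : ℤ) ∣ ((b i : ℕ) : ℤ) - (b' i : ℕ)) =
      Fintype.piFinset fun i =>
        Finset.univ.filter fun t : Fin M => (d : ℤ) ∣ ((b i : ℕ) : ℤ) - (t : ℕ) := by
    ext b'
    simp
  rw [h, Fintype.card_piFinset]
  simpa using Finset.prod_le_prod' fun i (_ : i ∈ Finset.univ) => card_fin_sub_dvd_le M d hd (b i)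

theorem card_solutions_mul_le {k : ℕ} (N M : ℕ) [NeZero N] (b b' : Fin k → Fin M) :
    (Finset.univ.filter fun x : Fin k → ZMod N =>
        ∑ i, ((b i : ℕ) : ZMod N) * x i = ∑ i, ((b' i : ℕ) : ZMod N) * x i).card * N ≤
      (if b = b' then N ^ (k + 1) else 0) +
        ∑ d ∈ Finset.Ico 1 M,
          if ∀ i, (d : ℤ) ∣ ((b i : ℕ) : ℤ) - (b' i : ℕ) then N ^ k * d else 0 := by
  by_cases h : b = b'
  · subst h
    simp [pow_succ, ZMod.card]
  obtain ⟨i, hi⟩ := Function.ne_iff.1 h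
  have hne : ((b i : ℕ) : ℤ) - (b' i : ℕ) ≠ 0 := by
    have := Fin.val_ne_of_ne hi
    omega
  obtain ⟨g, hg, hcard⟩ := exists_dvd_card_linear_solutions_mul_le N
    (a := fun i => ((b i : ℕ) : ℤ) - (b' i : ℕ)) fun h0 => hne (congrFun h0 i)
  have hgM : g ∈ Finset.Ico 1 M := by
    have h1 : g ≤ (((b i : ℕ) : ℤ) - (b' i : ℕ)).natAbs :=
      Nat.le_of_dvd (Int.natAbs_pos.2 hne) (Int.natCast_dvd.1 (hg i))
    have h2 : g ≠ 0 := fun h0 => hne (by simpa [h0] using hg i)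
    have := (b i).isLt
    have := (b' i).isLt
    rw [Finset.mem_Ico]
    omega
  rw [if_neg h, zero_add]
  refine le_trans (le_of_eq_of_le ?_ hcard) (le_of_eq_of_le (if_pos hg).symm
    (Finset.single_le_sum (f := fun d : ℕ =>
      if ∀ i, (d : ℤ) ∣ ((b i : ℕ) : ℤ) - (b' i : ℕ) then N ^ k * d else 0)
      (fun _ _ => Nat.zero_le _) hgM))
  congr 2
  ext x
  simp [sub_mul, Finset.sum_sub_distrib, sub_eq_zero]

theorem sum_eta_sq_mul_le (N M k : ℕ) [NeZero N] :
    (∑ x : Fin k → ZMod N, ∑ w : ZMod N, eta N M k x w ^ 2) * N ≤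
      M ^ k * N ^ (k + 1) +
        ∑ d ∈ Finset.Ico 1 M, M ^ k * ((M / d + 1) ^ k * (N ^ k * d)) := by
  have h1 : ∑ x : Fin k → ZMod N, ∑ w : ZMod N, eta N M k x w ^ 2 =
      ∑ b : Fin k → Fin M, ∑ b' : Fin k → Fin M,
        (Finset.univ.filter fun x : Fin k → ZMod N =>
          ∑ i, ((b i : ℕ) : ZMod N) * x i = ∑ i, ((b' i : ℕ) : ZMod N) * x i).card := by
    simp_rw [eta, sum_card_fiber_sq, Finset.card_filter]
    rw [Finset.sum_comm]
    exact Finset.sum_congr rfl fun b _ => Finset.sum_comm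
  have h2 : ∀ b : Fin k → Fin M, (∑ b' : Fin k → Fin M,
        (Finset.univ.filter fun x : Fin k → ZMod N =>
          ∑ i, ((b i : ℕ) : ZMod N) * x i = ∑ i, ((b' i : ℕ) : ZMod N) * x i).card) * N ≤
      N ^ (k + 1) + ∑ d ∈ Finset.Ico 1 M, (M / d + 1) ^ k * (N ^ k * d) := by
    intro b
    rw [Finset.sum_mul]
    refine (Finset.sum_le_sum fun b' _ => card_solutions_mul_le N M b b').trans ?_
    rw [Finset.sum_add_distrib, Finset.sum_comm]
    refine add_le_add (by simp) (Finset.sum_le_sum fun d hd => ?_)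
    rw [← Finset.sum_filter, Finset.sum_const, smul_eq_mul]
    exact Nat.mul_le_mul_right _ (card_pi_fin_sub_dvd_le M d (Finset.mem_Ico.1 hd).1 b)
  rw [h1, Finset.sum_mul, ← Finset.mul_sum, ← mul_add]
  simpa using Finset.sum_le_sum fun b (_ : b ∈ Finset.univ) => h2 b

theorem normalized_sum_eta_sq_le (N M k : ℕ) [NeZero N] (hM : M ^ k ≤ N) :
    (1 / (N : ℝ) ^ (k + 1)) *
        ∑ x : Fin k → ZMod N, ∑ w : ZMod N, (eta N M k x w : ℝ) ^ 2 ≤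
      (M : ℝ) ^ k / N + ∑ d ∈ Finset.Ico 1 M, (d : ℝ) * (1 / d + 1 / M) ^ k := by
  have hN : (0 : ℝ) < N := by exact_mod_cast Nat.pos_of_ne_zero (NeZero.ne N)
  have hMN : (M : ℝ) ^ k ≤ N := by exact_mod_cast hM
  have h : (∑ x : Fin k → ZMod N, ∑ w : ZMod N, (eta N M k x w : ℝ) ^ 2) * N ≤
      (M : ℝ) ^ k * N ^ (k + 1) + ∑ d ∈ Finset.Ico 1 M,
        (M : ℝ) ^ k * (((M / d + 1 : ℕ) : ℝ) ^ k * (N ^ k * d)) := by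
    exact_mod_cast sum_eta_sq_mul_le N M k
  have hterm : ∀ d ∈ Finset.Ico 1 M, (M : ℝ) ^ k * (((M / d + 1 : ℕ) : ℝ) ^ k * (N ^ k * d)) ≤
      (N : ℝ) ^ (k + 2) * ((d : ℝ) * (1 / d + 1 / M) ^ k) := by
    intro d hd
    rw [Finset.mem_Ico] at hd
    have hd0 : (0 : ℝ) < d := by exact_mod_cast hd.1
    have hM0 : (0 : ℝ) < M := by exact_mod_cast (by omega : 0 < M)
    have h1 : ((M / d + 1 : ℕ) : ℝ) ≤ M * (1 / d + 1 / M) := by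
      have := Nat.cast_div_le (α := ℝ) (m := M) (n := d)
      push_cast
      rw [mul_add, mul_one_div, mul_one_div_cancel hM0.ne']
      gcongr
    calc (M : ℝ) ^ k * (((M / d + 1 : ℕ) : ℝ) ^ k * (N ^ k * d))
        ≤ (M : ℝ) ^ k * ((M * (1 / d + 1 / M)) ^ k * (N ^ k * d)) := by gcongr
      _ = (M : ℝ) ^ k * (M : ℝ) ^ k * (N ^ k * (d * (1 / d + 1 / M) ^ k)) := by
        rw [mul_pow]; ring
      _ ≤ (N : ℝ) * N * (N ^ k * (d * (1 / d + 1 / M) ^ k)) := by gcongr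
      _ = _ := by ring
  have h' := h.trans (add_le_add le_rfl (Finset.sum_le_sum hterm))
  rw [← Finset.mul_sum] at h'
  rw [one_div_mul_eq_div, div_le_iff₀ (by positivity), ← mul_le_mul_iff_left₀ hN]
  refine h'.trans (le_of_eq ?_)
  field_simp
  ring

theorem tsum_inv_succ_pow_le {m : ℕ} (hm : 2 ≤ m) :
    ∑' n : ℕ, ((n : ℝ) + 1)⁻¹ ^ m ≤ Real.pi ^ 2 / 6 := by
  have hz := (hasSum_nat_add_iff' 1).2 hasSum_zeta_two
  simp only [Finset.sum_range_one, Nat.cast_zero, ne_eq, OfNat.ofNat_ne_zero, not_false_eq_true,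
    zero_pow, div_zero, sub_zero] at hz
  have hle : ∀ n : ℕ, ((n : ℝ) + 1)⁻¹ ^ m ≤ 1 / ((n + 1 : ℕ) : ℝ) ^ 2 := fun n => by
    rw [one_div, ← inv_pow, Nat.cast_add_one]
    exact pow_le_pow_of_le_one (by positivity)
      (inv_le_one_of_one_le₀ (by linarith [n.cast_nonneg (α := ℝ)])) hm
  rw [← hz.tsum_eq]
  exact (hz.summable.of_nonneg_of_le (fun n => by positivity) hle).tsum_le_tsum hle hz.summable

theorem tendsto_sum_Ico_mul_inv_add_inv_pow {k : ℕ} (hk : 3 ≤ k) :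
    Filter.Tendsto (fun M : ℕ => ∑ d ∈ Finset.Ico 1 M, (d : ℝ) * (1 / d + 1 / M) ^ k)
      Filter.atTop (nhds (∑' n : ℕ, ((n : ℝ) + 1)⁻¹ ^ (k - 1))) := by
  have hpow : ∀ n : ℕ, ((n : ℝ) + 1) * ((n : ℝ) + 1)⁻¹ ^ k = ((n : ℝ) + 1)⁻¹ ^ (k - 1) := by
    intro n
    obtain ⟨m, rfl⟩ : ∃ m, k = m + 1 := ⟨k - 1, by omega⟩
    rw [pow_succ', mul_inv_cancel_left₀ (by positivity)]
    rfl
  have hsummable : Summable fun n : ℕ => (2 : ℝ) ^ k * ((n : ℝ) + 1)⁻¹ ^ (k - 1) := by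
    refine Summable.mul_left _ ?_
    have := (summable_nat_add_iff 1).2
      (Real.summable_nat_pow_inv.2 (show 1 < k - 1 by omega))
    simpa using this
  let F : ℕ → ℕ → ℝ := fun M n =>
    if n + 1 < M then ((n : ℝ) + 1) * (((n : ℝ) + 1)⁻¹ + (M : ℝ)⁻¹) ^ k else 0
  have hF : ∀ M, ∑' n, F M n = ∑ d ∈ Finset.Ico 1 M, (d : ℝ) * (1 / d + 1 / M) ^ k := by
    intro M
    rw [tsum_eq_sum (s := Finset.range (M - 1)), Finset.sum_Ico_eq_sum_range]
    · refine Finset.sum_congr rfl fun n hn => ?_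
      rw [Finset.mem_range] at hn
      simp only [F]
      rw [if_pos (by omega)]
      simp [add_comm]
    · intro n hn
      rw [Finset.mem_range] at hn
      exact if_neg (by omega)
  simp_rw [← hF]
  refine tendsto_tsum_of_dominated_convergence hsummable (fun n => ?_)
    (Filter.Eventually.of_forall fun M n => ?_)
  · have hlim : Filter.Tendsto
        (fun M : ℕ => ((n : ℝ) + 1) * (((n : ℝ) + 1)⁻¹ + (M : ℝ)⁻¹) ^ k)
        Filter.atTop (nhds (((n : ℝ) + 1)⁻¹ ^ (k - 1))) := by
      have := ((tendsto_inv_atTop_nhds_zero_nat (𝕜 := ℝ)).const_add ((n : ℝ) + 1)⁻¹).pow k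
      rw [add_zero] at this
      simpa only [hpow] using this.const_mul ((n : ℝ) + 1)
    refine hlim.congr' ?_
    filter_upwards [Filter.eventually_gt_atTop (n + 1)] with M hM
    exact (if_pos hM).symm
  · simp only [F]
    split_ifs with h
    · have hle : (M : ℝ)⁻¹ ≤ ((n : ℝ) + 1)⁻¹ := by
        gcongr
        exact_mod_cast h.le
      rw [Real.norm_of_nonneg (by positivity), ← hpow, mul_left_comm, ← mul_pow]
      gcongr
      linarith
    · rw [norm_zero]
      positivity

theorem Mfl_pow_le {k : ℕ} (hk : k ≠ 0) (N : ℕ) : Mfl k N ^ k ≤ N := by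
  have h : (Mfl k N : ℝ) ≤ (N : ℝ) ^ ((1 : ℝ) / k) := Nat.floor_le (by positivity)
  have h2 := pow_le_pow_left₀ (by positivity) h k
  rw [one_div, Real.rpow_inv_natCast_pow (by positivity) hk] at h2
  exact_mod_cast h2

theorem tendsto_Mfl_atTop {k : ℕ} (hk : k ≠ 0) : Filter.Tendsto (Mfl k) Filter.atTop Filter.atTop :=
  tendsto_nat_floor_atTop.comp
    ((tendsto_rpow_atTop (by positivity)).comp tendsto_natCast_atTop_atTop)

/-- For fixed `k ≥ 3` and `M = ⌊N^(1/k)⌋`, the second moment of `η^x_w` is at most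
`M^k/N + π²/6 + ε` for all sufficiently large `N`. -/
theorem eta_second_moment_asymptotic_upper (k : ℕ) (hk : 3 ≤ k) (ε : ℝ) (hε : 0 < ε) :
    ∃ N₀ : ℕ, ∀ (N : ℕ) [NeZero N], N₀ ≤ N →
      (1 / (N : ℝ) ^ (k + 1)) *
          ∑ x : Fin k → ZMod N, ∑ w : ZMod N, (eta N (Mfl k N) k x w : ℝ) ^ 2 ≤
        ((Mfl k N : ℝ) ^ k) / N + Real.pi ^ 2 / 6 + ε := by
  have hk0 : k ≠ 0 := by omega
  have hlim := (tendsto_sum_Ico_mul_inv_add_inv_pow hk).comp (tendsto_Mfl_atTop hk0)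
  have hlt : ∑' n : ℕ, ((n : ℝ) + 1)⁻¹ ^ (k - 1) < Real.pi ^ 2 / 6 + ε := by
    linarith [tsum_inv_succ_pow_le (show 2 ≤ k - 1 by omega)]
  obtain ⟨N₀, hN₀⟩ := Filter.eventually_atTop.1 (hlim.eventually_lt_const hlt)
  refine ⟨N₀, fun N _ hN => ?_⟩
  have h := normalized_sum_eta_sq_le N (Mfl k N) k (Mfl_pow_le hk0 N)
  have h' := hN₀ N hN
  simp only [Function.comp_apply] at h'
  linarith
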